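/- arXiv:2405.03142 — 2 statements merged into one kernel-verified Lean document; each statement's English description precedes it below -/
import Mathlib

section
/- For every infinite cardinal κ₀ there exists a cardinal κ with κ₀ < κ ≤ 2^{κ₀} such that the weak diamond principle Φ_κ holds. -/
open Cardinal Set

/-- `C` is a club (closed and unbounded set) in the limit ordinal `δ`:
`C ⊆ δ`, the supremum of every nonempty subset of `C` bounded below `δ`
belongs to `C`, and `C` is unbounded in `δ`. -/
def IsClubIn (C : Set Ordinal) (δ : Ordinal) : Prop :=
  (∀ x ∈ C, x < δ) ∧
  (∀ s : Set Ordinal, s ⊆ C → s.Nonempty → sSup s < δ → sSup s ∈ C) ∧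
  (∀ β < δ, ∃ x ∈ C, β < x)

/-- `S` is a stationary subset of `lam`: `S ⊆ lam` and `S` meets every club of `lam`. -/
def IsStatIn (S : Set Ordinal) (lam : Ordinal) : Prop :=
  (∀ x ∈ S, x < lam) ∧ ∀ C : Set Ordinal, IsClubIn C lam → (S ∩ C).Nonempty

/-- The weak diamond principle `Φ_κ`: for every colouring `c` assigning to each
ordinal `α` and each function `f : Iio α → Bool` a value in `Bool`, there is
`g : Ordinal → Bool` such that for every `f : Ordinal → Bool` the set of `α < κ`
where `c` applied to `f ↾ α` equals `g α` is stationary in `κ`. -/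
def WeakDiamond (κ : Cardinal) : Prop :=
  ∀ c : (α : Ordinal) → (Set.Iio α → Bool) → Bool,
    ∃ g : Ordinal → Bool, ∀ f : Ordinal → Bool,
      IsStatIn {α : Ordinal | α < κ.ord ∧ c α (fun x => f x.1) = g α} κ.ord

universe u

theorem wd_club_inter {κ : Cardinal.{u}} (hreg : κ.IsRegular) (hω : ℵ₀ < κ) {I : Type u}
    [Nonempty I] (hI : #I < κ) (C : I → Set Ordinal.{u}) (h : ∀ i, IsClubIn (C i) κ.ord) :
    IsClubIn (⋂ i, C i) κ.ord := by
  obtain ⟨i₀⟩ := ‹Nonempty I›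
  refine ⟨fun x hx => (h i₀).1 x (mem_iInter.1 hx i₀), fun s hs hne hlt => ?_, fun β hβ => ?_⟩
  · exact mem_iInter.2 fun i => (h i).2.1 s (fun x hx => mem_iInter.1 (hs hx) i) hne hlt
  · have hnx : ∀ i, ∀ β : Ordinal.{u}, ∃ x, β < κ.ord → x ∈ C i ∧ β < x := by
      intro i β
      by_cases hb : β < κ.ord
      · obtain ⟨x, hx⟩ := (h i).2.2 β hb
        exact ⟨x, fun _ => hx⟩
      · exact ⟨0, fun h => absurd h hb⟩
    choose nx hnx using hnx
    let b : ℕ → Ordinal.{u} := fun n => Nat.rec β (fun _ x => ⨆ i, nx i x) n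
    have hb1 : ∀ n, b (n+1) = ⨆ i, nx i (b n) := fun n => rfl
    have hbk : ∀ n, b n < κ.ord := by
      intro n
      induction n with
      | zero => exact hβ
      | succ n ih =>
        rw [hb1]
        apply Ordinal.iSup_lt_of_lt_cof
        · rwa [hreg.cof_ord]
        · intro i
          exact (h i).1 _ (hnx i _ ih).1
    have hle : ∀ n i, nx i (b n) ≤ b (n+1) := fun n i => by
      rw [hb1]; exact Ordinal.le_iSup (fun i => nx i (b n)) i
    have hlt : ∀ n i, b n < nx i (b n) := fun n i => (hnx i _ (hbk n)).2
    have hsup : (⨆ n, b n) < κ.ord := by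
      apply Ordinal.lift_iSup_lt_of_lt_cof
      · rw [← Ordinal.lift_cof, hreg.cof_ord]; simpa using hω
      · exact hbk
    refine ⟨⨆ n, b n, mem_iInter.2 fun i => ?_, ?_⟩
    · have : (⨆ n, b n) = sSup (range fun n => nx i (b n)) := by
        apply le_antisymm
        · apply Ordinal.iSup_le
          intro n
          exact (hlt n i).le.trans (Ordinal.le_iSup (fun n => nx i (b n)) n)
        · apply Ordinal.iSup_le
          intro n
          exact (hle n i).trans (Ordinal.le_iSup b (n+1))
      rw [this] at hsup ⊢
      apply (h i).2.1 _ _ (range_nonempty _) hsup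
      rintro _ ⟨n, rfl⟩
      exact (hnx i _ (hbk n)).1
    · exact (hlt 0 i₀).trans_le ((hle 0 i₀).trans (Ordinal.le_iSup b 1))

theorem wd_regular {κ₀ κ : Cardinal.{u}} (hκ₀ : ℵ₀ ≤ κ₀) (hlt : κ₀ < κ)
    (hmin : ∀ μ < κ, (2 : Cardinal.{u}) ^ μ ≤ 2 ^ κ₀) (hbig : (2 : Cardinal.{u}) ^ κ₀ < 2 ^ κ) :
    κ.IsRegular := by
  have hinf : ℵ₀ ≤ κ := hκ₀.trans hlt.le
  refine ⟨hinf, ?_⟩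
  by_contra hcof
  push Not at hcof
  obtain ⟨S, hS, hSc⟩ := Order.exists_cof_eq κ.ord.ToType
  rw [Ordinal.cof_toType] at hSc
  have hlim := Cardinal.isSuccLimit_ord hinf
  have : NoMaxOrder κ.ord.ToType := Cardinal.noMaxOrder hinf
  let Φ : (κ.ord.ToType → Bool) → (∀ s : S, (Iio s.1 → Bool)) := fun f s x => f x.1
  have hinj : ∀ s : S, #(Iio s.1 → Bool) ≤ 2 ^ κ₀ := by
    intro s
    have e : #(Iio s.1 → Bool) = 2 ^ #(Iio s.1) := by simp
    rw [e]
    exact hmin _ (Cardinal.mk_Iio_toType_ord_lt s.1)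
  have hSlt : κ₀ * #S < κ := Cardinal.mul_lt_of_lt hinf hlt (hSc ▸ hcof)
  have hΦ : Function.Injective Φ := by
    intro f g hfg
    funext x
    obtain ⟨y, hy⟩ := exists_gt x
    obtain ⟨s, hs, hys⟩ := hS y
    exact congrFun (congrFun hfg ⟨s, hs⟩) ⟨x, hy.trans_le hys⟩
  have h1 := mk_le_of_injective hΦ
  have h2 := (h1.trans (mk_pi _).le).trans (prod_le_prod _ _ hinj)
  rw [prod_const', ← power_mul] at h2
  have h3 := h2.trans (hmin _ hSlt)
  have e : #(κ.ord.ToType → Bool) = 2 ^ κ := by simp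
  rw [e] at h3
  exact h3.not_gt hbig

theorem wd_card {κ₀ κ : Cardinal.{u}} (hκ₀ : ℵ₀ ≤ κ₀) (hlt : κ₀ < κ) (hle : κ ≤ 2 ^ κ₀)
    (hmin : ∀ μ < κ, (2 : Cardinal.{u}) ^ μ ≤ 2 ^ κ₀) :
    #(Σ α : Iio κ.ord, (ℕ → Iio α.1 → κ₀.out → Bool)) ≤ lift.{u+1} (2 ^ κ₀) := by
  have hinf : ℵ₀ ≤ κ := hκ₀.trans hlt.le
  rw [mk_sigma]
  have h1 : ∀ α : Iio κ.ord, #(ℕ → Iio α.1 → κ₀.out → Bool) ≤ lift.{u+1} (2 ^ κ₀) := by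
    intro α
    have hα : α.1.card < κ := Cardinal.lt_ord.1 α.2
    have : #(ℕ → Iio α.1 → κ₀.out → Bool) = lift.{u+1} (2 ^ (κ₀ * α.1.card * ℵ₀)) := by
      simp [Cardinal.mk_Iio_ordinal, Cardinal.power_mul]
    rw [this, lift_le]
    exact hmin _ (mul_lt_of_lt hinf (mul_lt_of_lt hinf hlt hα) (hκ₀.trans_lt hlt))
  refine (sum_le_sum _ _ h1).trans ?_
  rw [sum_const', Cardinal.mk_Iio_ordinal, card_ord, ← lift_mul, lift_le]
  exact (mul_le_mul_left hle _).trans (mul_eq_self (hκ₀.trans (hlt.le.trans hle))).le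

theorem wd_step {κ₀ κ : Cardinal.{u}} (hκ₀ : ℵ₀ ≤ κ₀) (hlt : κ₀ < κ) (hreg : κ.IsRegular)
    (c : (α : Ordinal.{u}) → (Set.Iio α → Bool) → Bool)
    (hc : ∀ g : Ordinal.{u} → Bool, ∃ f : Ordinal.{u} → Bool, ∃ C, IsClubIn C κ.ord ∧
      ∀ α ∈ C, c α (fun x => f x.1) = g α)
    (code : (Σ α : Iio κ.ord, (ℕ → Iio α.1 → κ₀.out → Bool)) → (κ₀.out → Bool))
    (s : (Ordinal.{u} → κ₀.out → Bool) × {C // IsClubIn C κ.ord}) :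
    ∃ t : (Ordinal.{u} → κ₀.out → Bool) × {C // IsClubIn C κ.ord}, t.2.1 ⊆ s.2.1 ∧
      ∃ n : Ordinal.{u} → Iio κ.ord,
        (∀ α < κ.ord, α < (n α).1 ∧ (n α).1 ∈ s.2.1 ∧ ∀ y ∈ s.2.1, α < y → (n α).1 ≤ y) ∧
        ∀ α ∈ t.2.1, (fun j => c α (fun x => t.1 x.1 j)) = code ⟨n α, fun _ x => s.1 x.1⟩ := by
  have hne : Nonempty κ₀.out := by
    rw [← mk_ne_zero_iff, mk_out]; exact (aleph0_pos.trans_le hκ₀).ne'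
  obtain ⟨f₀, C, hC⟩ := s
  have hn : ∀ α : Ordinal.{u}, ∃ n : Iio κ.ord, α < κ.ord →
      α < n.1 ∧ n.1 ∈ C ∧ ∀ y ∈ C, α < y → n.1 ≤ y := by
    intro α
    by_cases ha : α < κ.ord
    · have hne : {x | x ∈ C ∧ α < x}.Nonempty := hC.2.2 α ha
      have := csInf_mem hne
      exact ⟨⟨sInf {x | x ∈ C ∧ α < x}, hC.1 _ this.1⟩, fun _ => ⟨this.2, this.1, fun y hy hay =>
        csInf_le' ⟨hy, hay⟩⟩⟩
    · exact ⟨⟨0, hreg.ord_pos⟩, fun h => absurd h ha⟩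
  choose n hn using hn
  choose f D hD hf using fun j => hc (fun α => code ⟨n α, fun _ x => f₀ x.1⟩ j)
  have hω : ℵ₀ < κ := hκ₀.trans_lt hlt
  have hE : IsClubIn (⋂ o : Option κ₀.out, o.elim C D) κ.ord := by
    apply wd_club_inter hreg hω
    · rw [mk_option, mk_out]
      exact add_lt_of_lt hreg.aleph0_le hlt (one_lt_aleph0.trans hω)
    · rintro (_ | j)
      · exact hC
      · exact hD j
  refine ⟨⟨fun x j => f j x, _, hE⟩, fun x hx => mem_iInter.1 hx none, n, hn, fun α hα => ?_⟩
  funext j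
  exact hf j α (mem_iInter.1 hα (some j))

theorem wd_main {κ₀ κ : Cardinal.{u}} (hκ₀ : ℵ₀ ≤ κ₀) (hlt : κ₀ < κ) (hle : κ ≤ 2 ^ κ₀)
    (hmin : ∀ μ < κ, (2 : Cardinal.{u}) ^ μ ≤ 2 ^ κ₀) (hreg : κ.IsRegular)
    (c : (α : Ordinal.{u}) → (Set.Iio α → Bool) → Bool)
    (hc : ∀ g : Ordinal.{u} → Bool, ∃ f : Ordinal.{u} → Bool, ∃ C, IsClubIn C κ.ord ∧
      ∀ α ∈ C, c α (fun x => f x.1) = g α) : (2 : Cardinal.{u}) ^ κ ≤ 2 ^ κ₀ := by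
  have hω : ℵ₀ < κ := hκ₀.trans_lt hlt
  have hcard := wd_card hκ₀ hlt hle hmin
  have hcode : Nonempty ((Σ α : Iio κ.ord, (ℕ → Iio α.1 → κ₀.out → Bool)) ↪
      (κ₀.out → Bool)) := by
    rw [← lift_mk_le']
    simpa using hcard
  obtain ⟨code, hcode⟩ := hcode
  choose step hsub n hn hstep using wd_step hκ₀ hlt hreg c hc code
  have key : ∀ s s', ∀ ε ∈ (step s).2.1, ε ∈ (step s').2.1 →
      (∀ x < ε, (step s).1 x = (step s').1 x) →
      ∃ β, ε < β ∧ β < κ.ord ∧ β ∈ s.2.1 ∧ β ∈ s'.2.1 ∧ (∀ y ∈ s.2.1, ε < y → β ≤ y) ∧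
        ∀ x < β, s.1 x = s'.1 x := by
    intro s s' ε h1 h2 hag
    have hεκ : ε < κ.ord := (step s).2.2.1 _ h1
    have e1 := hstep s ε h1
    have e2 := hstep s' ε h2
    have e3 : (fun j => c ε (fun x => (step s).1 x.1 j)) =
        (fun j => c ε (fun x => (step s').1 x.1 j)) := by
      funext j
      congr 1
      funext x
      rw [hag x.1 x.2]
    have e4 := hcode (e1.symm.trans (e3.trans e2))
    obtain ⟨p1, p2, p3⟩ := hn s ε hεκ
    obtain ⟨q1, q2, q3⟩ := hn s' ε hεκ
    rw [Sigma.mk.injEq] at e4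
    obtain ⟨e5, e6⟩ := e4
    refine ⟨(n s ε).1, p1, (n s ε).2, p2, e5 ▸ q2, p3, ?_⟩
    have gen : ∀ (a b : Iio κ.ord) (u v : Ordinal.{u} → κ₀.out → Bool), a = b →
        (fun (_ : ℕ) (x : Iio a.1) => u x.1) ≍ (fun (_ : ℕ) (x : Iio b.1) => v x.1) →
        ∀ x < a.1, u x = v x := by
      rintro a b u v rfl h x hx
      exact congrFun (congrFun (eq_of_heq h) 0) ⟨x, hx⟩
    exact gen _ _ _ _ e5 e6
  have huniv : IsClubIn (Iio κ.ord) κ.ord := by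
    refine ⟨fun x hx => hx, fun s _ _ h => h, fun β hβ => ?_⟩
    exact ⟨_, (isSuccLimit_ord hreg.aleph0_le).succ_lt hβ, Order.lt_succ β⟩
  let st : (Iio κ.ord → Bool) → ℕ → (Ordinal.{u} → κ₀.out → Bool) × {C // IsClubIn C κ.ord} :=
    fun h n => Nat.rec ⟨fun x _ => if hx : x < κ.ord then h ⟨x, hx⟩ else false, _, huniv⟩
      (fun _ s => step s) n
  have hst : ∀ h n, st h (n+1) = step (st h n) := fun _ _ => rfl
  have hanti : ∀ h, Antitone fun n => (st h n).2.1 := fun h =>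
    antitone_nat_of_succ_le fun n => hsub (st h n)
  have hI : ∀ h, ∃ α, α < κ.ord ∧ ∀ n, α ∈ (st h n).2.1 := by
    intro h
    have := wd_club_inter hreg hω (I := ULift.{u} ℕ) (by simpa using hω)
      (fun n => (st h n.down).2.1) (fun n => (st h n.down).2.2)
    obtain ⟨α, hα, -⟩ := this.2.2 0 hreg.ord_pos
    exact ⟨α, this.1 _ hα, fun n => mem_iInter.1 hα ⟨n⟩⟩
  choose a hak ha using hI
  let Φ : (Iio κ.ord → Bool) → (Σ α : Iio κ.ord, (ℕ → Iio α.1 → κ₀.out → Bool)) :=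
    fun h => ⟨⟨a h, hak h⟩, fun n x => (st h n).1 x.1⟩
  have hΦ : Function.Injective Φ := by
    intro h h' hh
    have h0 : a h = a h' ∧ ∀ n, ∀ x < a h, (st h n).1 x = (st h' n).1 x := by
      simp only [Φ, Sigma.mk.injEq] at hh
      have gen : ∀ (a b : Iio κ.ord) (u v : ℕ → Ordinal.{u} → κ₀.out → Bool), a = b →
        (fun (n : ℕ) (x : Iio a.1) => u n x.1) ≍ (fun (n : ℕ) (x : Iio b.1) => v n x.1) →
        a.1 = b.1 ∧ ∀ n, ∀ x < a.1, u n x = v n x := by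
        rintro a b u v rfl h
        exact ⟨rfl, fun n x hx => congrFun (congrFun (eq_of_heq h) n) ⟨x, hx⟩⟩
      exact gen ⟨a h, hak h⟩ ⟨a h', hak h'⟩ (fun n => (st h n).1) (fun n => (st h' n).1) hh.1 hh.2
    have down : ∀ k m, ∀ ε ∈ (st h (m+k)).2.1, ε ∈ (st h' (m+k)).2.1 →
        (∀ x < ε, (st h (m+k)).1 x = (st h' (m+k)).1 x) →
        ∀ x < ε, (st h m).1 x = (st h' m).1 x := by
      intro k
      induction k with
      | zero => intro m ε _ _ h3; exact h3
      | succ k ih =>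
        intro m ε h1 h2 h3
        obtain ⟨β, b1, b2, b3, b4, b5, b6⟩ := key (st h (m+k)) (st h' (m+k)) ε h1 h2 h3
        exact ih m ε (hsub (st h (m+k)) h1) (hsub (st h' (m+k)) h2)
          fun x hx => b6 x (hx.trans b1)
    let G : Set Ordinal.{u} := {α | ∀ n, α ∈ (st h n).2.1 ∧ α ∈ (st h' n).2.1 ∧
      ∀ x < α, (st h n).1 x = (st h' n).1 x}
    have hGκ : ∀ α ∈ G, α < κ.ord := fun α hα => (st h 0).2.2.1 _ (hα 0).1
    have hG0 : a h ∈ G := fun n => ⟨ha h n, h0.1 ▸ ha h' n, h0.2 n⟩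
    have hGn : ∀ δ ∈ G, ∃ β ∈ G, δ < β := by
      intro δ hδ
      choose b b1 b2 b3 b4 b5 b6 using fun n => key (st h n) (st h' n) δ
        (hδ (n+1)).1 (hδ (n+1)).2.1 (hδ (n+1)).2.2
      have hmono : Monotone b := monotone_nat_of_le_succ fun n =>
        b5 n _ (hsub _ (b3 (n+1))) (b1 (n+1))
      have hsup : (⨆ n, b n) < κ.ord := by
        apply Ordinal.lift_iSup_lt_of_lt_cof
        · rw [← Ordinal.lift_cof, hreg.cof_ord]; simpa using hω
        · exact b2
      have htail : ∀ n, (⨆ n, b n) = sSup (range fun m => b (n+m)) := by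
        intro n
        apply le_antisymm
        · apply Ordinal.iSup_le
          intro m
          exact (hmono (Nat.le_add_left m n)).trans (Ordinal.le_iSup (fun m => b (n+m)) m)
        · apply Ordinal.iSup_le
          intro m
          exact Ordinal.le_iSup b (n+m)
      refine ⟨⨆ n, b n, fun n => ⟨?_, ?_, ?_⟩, (b1 0).trans_le (Ordinal.le_iSup b 0)⟩
      · rw [htail n] at hsup ⊢
        refine (st h n).2.2.2.1 _ ?_ (range_nonempty _) hsup
        rintro _ ⟨m, rfl⟩
        exact hanti h (Nat.le_add_right n m) (b3 (n+m))
      · rw [htail n] at hsup ⊢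
        refine (st h' n).2.2.2.1 _ ?_ (range_nonempty _) hsup
        rintro _ ⟨m, rfl⟩
        exact hanti h' (Nat.le_add_right n m) (b4 (n+m))
      · intro x hx
        rw [htail n] at hx
        obtain ⟨m, hm⟩ := Ordinal.lt_iSup_iff.1 hx
        exact down m n _ (b3 (n+m)) (b4 (n+m)) (b6 (n+m)) x hm
    have hbdd : BddAbove G := ⟨κ.ord, fun x hx => (hGκ x hx).le⟩
    have hGs : ¬ sSup G < κ.ord := by
      intro hs
      have : sSup G ∈ G := by
        refine fun n => ⟨(st h n).2.2.2.1 _ (fun x hx => (hx n).1) ⟨_, hG0⟩ hs,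
          (st h' n).2.2.2.1 _ (fun x hx => (hx n).2.1) ⟨_, hG0⟩ hs, fun x hx => ?_⟩
        obtain ⟨y, hy, hxy⟩ := exists_lt_of_lt_csSup ⟨_, hG0⟩ hx
        exact (hy n).2.2 x hxy
      obtain ⟨β, hβ, hlt⟩ := hGn _ this
      exact (le_csSup hbdd hβ).not_gt hlt
    funext x
    obtain ⟨y, hy, hxy⟩ := exists_lt_of_lt_csSup ⟨_, hG0⟩ (lt_of_lt_of_le x.2 (not_lt.1 hGs))
    have hne : Nonempty κ₀.out := by
      rw [← mk_ne_zero_iff, mk_out]; exact (aleph0_pos.trans_le hκ₀).ne'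
    have := congrFun ((hy 0).2.2 x.1 hxy) hne.some
    have hx : x.1 < κ.ord := x.2
    simpa [st, hx] using this
  have := (mk_le_of_injective hΦ).trans hcard
  have e : #(Iio κ.ord → Bool) = lift.{u+1} (2 ^ κ) := by
    simp [Cardinal.mk_Iio_ordinal]
  rwa [e, lift_le] at this

/-- For every infinite cardinal `κ₀` there exists a cardinal `κ` with
`κ₀ < κ ≤ 2 ^ κ₀` such that the weak diamond `Φ_κ` holds. -/
theorem weakDiamond_exists (κ₀ : Cardinal) (hκ₀ : ℵ₀ ≤ κ₀) :
    ∃ κ : Cardinal, κ₀ < κ ∧ κ ≤ 2 ^ κ₀ ∧ WeakDiamond κ := by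
  let T : Set Cardinal := {κ | (2 : Cardinal) ^ κ₀ < 2 ^ κ}
  have hT : (2 : Cardinal) ^ κ₀ ∈ T := cantor _
  have hmem : (2 : Cardinal) ^ κ₀ < 2 ^ sInf T := csInf_mem ⟨_, hT⟩
  have hle : sInf T ≤ 2 ^ κ₀ := csInf_le' hT
  have hmin : ∀ μ < sInf T, (2 : Cardinal) ^ μ ≤ 2 ^ κ₀ := fun μ hμ =>
    not_lt.1 fun h => (csInf_le' (s := T) h).not_gt hμ
  have hlt : κ₀ < sInf T := by
    by_contra h
    exact (power_le_power_left two_ne_zero (not_lt.1 h)).not_gt hmem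
  refine ⟨sInf T, hlt, hle, ?_⟩
  have hreg := wd_regular hκ₀ hlt hmin hmem
  intro c
  by_contra hcon
  push Not at hcon
  refine (wd_main hκ₀ hlt hle hmin hreg c fun g => ?_).not_gt hmem
  obtain ⟨f, hf⟩ := hcon fun α => !g α
  unfold IsStatIn at hf
  push Not at hf
  obtain ⟨C, hC, hd⟩ := hf fun x hx => hx.1
  refine ⟨f, C, hC, fun α hα => ?_⟩
  by_contra hne
  have : α ∈ ({α | α < (sInf T).ord ∧ c α (fun x => f x.1) = !g α} ∩ C : Set Ordinal) :=
    ⟨⟨hC.1 _ hα, Bool.eq_not_of_ne hne⟩, hα⟩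
  rw [hd] at this
  exact this
end

section
/- Let η be an infinite cardinal and suppose there exists a club guessing sequence on S^{η⁺⁺}_{η⁺} (a sequence (C_α : α ∈ S^{η⁺⁺}_{η⁺}) with each C_α a club of α such that every club of η⁺⁺ contains some C_α). Let ρ be an ordinal and let cℓ be an operation on subsets of ρ+1 (i.e., on sets of ordinals ≤ ρ) satisfying: (i) cℓ(∅) = ∅; (ii) x ⊆ cℓ(x) for every x; (iii) x ⊆ y implies cℓ(x) ⊆ cℓ(y); (iv) cℓ(x ∪ y) = cℓ(x) ∪ cℓ(y); (v) cℓ(cℓ(x)) = cℓ(x); (vi) if γ ∈ cℓ(x) then there exists y ⊆ x with |y| ≤ η and γ ∈ cℓ(y); (vii) for every nonempty x ⊆ ρ+1 the set cℓ(x) has a largest element; (viii) for every ordinal γ ≤ ρ with ω < cf(γ) ≤ γ there is a club c of γ such that cℓ(c) ⊆ γ+1. Then |ρ| ≤ η⁺⁺ (equivalently, |ρ| < η⁺⁺⁺). -/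
open Cardinal Set

universe u

/-- Suprema of families indexed in the next universe. -/
theorem aux_iSup_lt {ι : Type (u + 1)} {f : ι → Ordinal.{u}} {a : Ordinal.{u}}
    (ha : #ι < Cardinal.lift.{u + 1} a.cof) (hf : ∀ i, f i < a) : ⨆ i, f i < a := by
  apply Ordinal.sSup_lt_of_lt_cof
  · rw [← Ordinal.lift_cof]
    exact mk_range_le.trans_lt ha
  · rintro _ ⟨i, rfl⟩
    exact hf i

/-- The recursive construction of the normal sequence. -/
theorem aux_exists_seq (lam : Ordinal.{u}) (C : Ordinal.{u} → Set Ordinal.{u})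
    (F : Set Ordinal.{u} → Ordinal.{u}) :
    ∃ g : Ordinal.{u} → Ordinal.{u}, ∀ i, g i = ⨆ j : Iio i,
      max (g j + 1) (⨆ a : Iio lam, (F {o | ∃ k, k < j.1 ∧ k ∈ C a ∧ g k = o} + 1)) := by
  let G : ∀ i : Ordinal.{u}, (∀ j, j < i → Ordinal.{u}) → Ordinal.{u} := fun i g =>
    ⨆ j : Iio i, max (g j.1 j.2 + 1) (⨆ a : Iio lam,
      (F {o | ∃ k, ∃ h : k < j.1, k ∈ C a ∧ g k (h.trans j.2) = o} + 1))
  refine ⟨(wellFounded_lt (α := Ordinal.{u})).fix G, fun i => ?_⟩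
  rw [WellFounded.fix_eq]
  simp only [G, exists_prop]

/-- A normal function has club many values in a given club, on the index side. -/
theorem aux_club {g : Ordinal.{u} → Ordinal.{u}} (hg : Order.IsNormal g) {lam : Ordinal.{u}}
    (hlam : ℵ₀ < lam.cof) (hlim : Order.IsSuccLimit lam) {c : Set Ordinal.{u}}
    (hc : IsClubIn c (g lam)) : IsClubIn {i | i < lam ∧ g i ∈ c} lam := by
  obtain ⟨hc1, hc2, hc3⟩ := hc
  refine ⟨fun x hx => hx.1, ?_, ?_⟩
  · intro s hs hne hlt
    refine ⟨hlt, ?_⟩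
    have hb : BddAbove s := ⟨lam, fun x hx => (hs hx).1.le⟩
    have h := hg.map_sSup hne hb
    rw [h]
    apply hc2
    · rintro _ ⟨x, hx, rfl⟩
      exact (hs hx).2
    · exact hne.image g
    · rw [← h]; exact hg.strictMono hlt
  · intro β hβ
    have step : ∀ b : Iio lam, ∃ b' : Iio lam, ∃ x ∈ c, b.1 < b'.1 ∧ g b < x ∧ x < g b' := by
      rintro ⟨b, hb⟩
      obtain ⟨x, hx, hbx⟩ := hc3 (g b) (hg.strictMono hb)
      obtain ⟨b', hb', hxb'⟩ := (hg.lt_iff_exists_lt hlim).1 (hc1 x hx)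
      exact ⟨⟨b', hb'⟩, x, hx, hg.strictMono.lt_iff_lt.1 (hbx.trans hxb'), hbx, hxb'⟩
    choose nx x hxc hlt hgx hxg using step
    let B : ℕ → Iio lam := fun n => nx^[n] ⟨β, hβ⟩
    have hB : ∀ n, B (n + 1) = nx (B n) := fun n => Function.iterate_succ_apply' _ _ _
    have hsup : (⨆ n, (B n).1) < lam := by
      apply Ordinal.lift_iSup_lt_of_lt_cof
      · simpa using hlam
      · exact fun n => (B n).2
    have hbdd : BddAbove (range fun n => (B n).1) := ⟨lam, by rintro _ ⟨n, rfl⟩; exact (B n).2.le⟩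
    have hle : ∀ n, (B n).1 ≤ ⨆ n, (B n).1 := fun n => le_ciSup hbdd n
    have hbx : BddAbove (range fun n => x (B n)) :=
      ⟨g lam, by rintro _ ⟨n, rfl⟩; exact (hc1 _ (hxc _)).le⟩
    have heq : g (⨆ n, (B n).1) = ⨆ n, x (B n) := by
      rw [hg.map_iSup hbdd]
      apply le_antisymm
      · exact ciSup_le fun n => (hgx (B n)).le.trans (le_ciSup hbx n)
      · apply ciSup_le
        intro n
        have h1 : x (B n) ≤ g (B (n + 1)) := by rw [hB]; exact (hxg (B n)).le
        refine h1.trans (le_ciSup (f := fun n => g (B n).1) ?_ (n + 1))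
        exact ⟨g lam, by rintro _ ⟨n, rfl⟩; exact (hg.strictMono (B n).2).le⟩
    refine ⟨⨆ n, (B n).1, ⟨hsup, ?_⟩, ?_⟩
    · have : sSup (range fun n => x (B n)) ∈ c := by
        apply hc2
        · rintro _ ⟨n, rfl⟩; exact hxc _
        · exact range_nonempty _
        · change (⨆ n, x (B n)) < _
          rw [← heq]; exact hg.strictMono hsup
      rw [heq]; exact this
    · have h0 := hlt (B 0)
      rw [← hB] at h0
      exact lt_of_lt_of_le h0 (hle 1)

/-- Combinatorial core of the pcf bound `|pcf 𝔞| < |𝔞|⁺⁺⁺`: given a club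
guessing sequence on `S^{η⁺⁺}_{η⁺}` and a closure operation `cl` on subsets of
`Iic ρ` satisfying the pcf-style axioms (monotone idempotent additive closure
operator, `η`-localization, existence of last elements, and clubs with bounded
closure at points of uncountable cofinality), one gets `|ρ| ≤ η⁺⁺`. -/
theorem card_le_of_closure_operator (η : Cardinal) (hη : ℵ₀ ≤ η)
    (hcg : ∃ C : Ordinal → Set Ordinal,
      (∀ α : Ordinal, α < (Order.succ (Order.succ η)).ord →
        α.cof = Order.succ η → IsClubIn (C α) α) ∧
      ∀ E : Set Ordinal, IsClubIn E (Order.succ (Order.succ η)).ord →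
        ∃ α : Ordinal, α < (Order.succ (Order.succ η)).ord ∧
          α.cof = Order.succ η ∧ C α ⊆ E)
    (ρ : Ordinal) (cl : Set Ordinal → Set Ordinal)
    (hcl : ∀ x ⊆ Set.Iic ρ, cl x ⊆ Set.Iic ρ)
    (h1 : cl ∅ = ∅)
    (h2 : ∀ x ⊆ Set.Iic ρ, x ⊆ cl x)
    (h3 : ∀ x y : Set Ordinal, x ⊆ y → y ⊆ Set.Iic ρ → cl x ⊆ cl y)
    (h4 : ∀ x y : Set Ordinal, x ⊆ Set.Iic ρ → y ⊆ Set.Iic ρ →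
      cl (x ∪ y) = cl x ∪ cl y)
    (h5 : ∀ x ⊆ Set.Iic ρ, cl (cl x) = cl x)
    (h6 : ∀ x ⊆ Set.Iic ρ, ∀ γ ∈ cl x,
      ∃ y ⊆ x, (∃ f : ↥y → ↥(Set.Iio η.ord), Function.Injective f) ∧ γ ∈ cl y)
    (h7 : ∀ x ⊆ Set.Iic ρ, x.Nonempty → ∃ m ∈ cl x, ∀ z ∈ cl x, z ≤ m)
    (h8 : ∀ γ ≤ ρ, ℵ₀ < γ.cof → γ.cof.ord ≤ γ →
      ∃ c : Set Ordinal, IsClubIn c γ ∧ cl c ⊆ Set.Iic γ) :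
    ρ.card ≤ Order.succ (Order.succ η) := by
  classical
  obtain ⟨C, hC, hguess⟩ := hcg
  by_contra hcon
  rw [not_le] at hcon
  have hη1 : ℵ₀ ≤ Order.succ η := hη.trans (Order.le_succ η)
  have hη2 : ℵ₀ ≤ Order.succ (Order.succ η) := hη1.trans (Order.le_succ _)
  have hlreg := isRegular_succ hη1
  have hkreg := isRegular_succ hη2
  set L := Order.succ (Order.succ η) with hL
  set K := Order.succ L with hK
  set lam := L.ord with hlam
  set κ := K.ord with hκ
  have hlk : L < K := Order.lt_succ L
  have hlamκ : lam < κ := Cardinal.ord_lt_ord.2 hlk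
  have hκρ : κ ≤ ρ := by
    rw [hκ, Cardinal.ord_le]
    exact Order.succ_le_of_lt hcon
  have hlamcof : lam.cof = L := hlreg.cof_ord
  have hκcof : κ.cof = K := hkreg.cof_ord
  have hlamlim : Order.IsSuccLimit lam := Cardinal.isSuccLimit_ord hη2
  have hκlim : Order.IsSuccLimit κ := Cardinal.isSuccLimit_ord hkreg.1
  let F : Set Ordinal → Ordinal := fun s =>
    if h : ∃ m, m < κ ∧ m ∈ cl s ∧ ∀ z ∈ cl s, z ≤ m then h.choose else 0
  have hFlt : ∀ s, F s < κ := by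
    intro s
    by_cases h : ∃ m, m < κ ∧ m ∈ cl s ∧ ∀ z ∈ cl s, z ≤ m
    · simp only [F, dif_pos h]; exact h.choose_spec.1
    · simp only [F, dif_neg h]; exact hkreg.ord_pos
  have hFle : ∀ s m, m < κ → m ∈ cl s → (∀ z ∈ cl s, z ≤ m) → m ≤ F s := by
    intro s m hm hms hmax
    have h : ∃ m, m < κ ∧ m ∈ cl s ∧ ∀ z ∈ cl s, z ≤ m := ⟨m, hm, hms, hmax⟩
    simp only [F, dif_pos h]
    exact h.choose_spec.2.2 m hms
  obtain ⟨g, hgdef⟩ := aux_exists_seq lam C F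
  have hstep : ∀ i j, j < i → g j < g i := by
    intro i j hj
    rw [hgdef i]
    refine lt_of_lt_of_le ?_ (Ordinal.le_iSup _ (⟨j, hj⟩ : Iio i))
    exact lt_of_lt_of_le (Order.lt_add_one_iff.2 le_rfl) (le_max_left _ _)
  have hstepF : ∀ i j a, j < i → a < lam →
      F {o | ∃ k, k < j ∧ k ∈ C a ∧ g k = o} < g i := by
    intro i j a hj ha
    rw [hgdef i]
    refine lt_of_lt_of_le ?_ (Ordinal.le_iSup _ (⟨j, hj⟩ : Iio i))
    refine lt_of_lt_of_le ?_ (le_max_right _ _)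
    refine lt_of_lt_of_le ?_ (Ordinal.le_iSup _ (⟨a, ha⟩ : Iio lam))
    exact Order.lt_add_one_iff.2 le_rfl
  have hnorm : Order.IsNormal g := by
    rw [Order.isNormal_iff]
    refine ⟨fun j i h => hstep i j h, ?_⟩
    intro o ho a ha
    rw [hgdef o]
    apply Ordinal.iSup_le
    rintro ⟨j, hj⟩
    have hj' : j + 1 < o := ho.add_one_lt hj
    have hjj : j < j + 1 := Order.lt_add_one_iff.2 le_rfl
    refine le_trans ?_ (ha _ hj')
    apply max_le
    · exact Order.add_one_le_of_lt (hstep _ _ hjj)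
    · apply Ordinal.iSup_le
      rintro ⟨b, hb⟩
      exact Order.add_one_le_of_lt (hstepF _ _ _ hjj hb)
  have hgκ : ∀ i, i < κ → g i < κ := by
    intro i
    induction i using WellFoundedLT.induction with
    | ind i ih =>
      intro hi
      rw [hgdef i]
      apply aux_iSup_lt
      · rw [Cardinal.mk_Iio_ordinal, Cardinal.lift_lt, hκcof]
        exact Cardinal.lt_ord.1 hi
      · rintro ⟨j, hj⟩
        apply max_lt
        · exact hκlim.add_one_lt (ih j hj (lt_trans hj hi))
        · apply aux_iSup_lt
          · rw [Cardinal.mk_Iio_ordinal, Cardinal.lift_lt, hκcof]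
            exact Cardinal.lt_ord.1 hlamκ
          · intro a
            exact hκlim.add_one_lt (hFlt _)
  have hδκ : g lam < κ := hgκ lam hlamκ
  have hδcof : (g lam).cof = L := by
    rw [Ordinal.cof_map_of_isNormal hnorm hlamlim, hlamcof]
  have hLω : ℵ₀ < L := lt_of_le_of_lt hη1 (Order.lt_succ _)
  obtain ⟨c, hc, hclc⟩ := h8 (g lam) (hδκ.le.trans hκρ) (by rw [hδcof]; exact hLω)
    (Ordinal.ord_cof_le _)
  have hcρ : c ⊆ Set.Iic ρ := fun x hx => ((hc.1 x hx).trans hδκ).le.trans hκρ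
  obtain ⟨α, hαlam, hαcof, hCE⟩ := hguess _
    (aux_club hnorm (by rw [hlamcof]; exact hLω) hlamlim hc)
  obtain ⟨hC1, hC2, hC3⟩ := hC α hαlam hαcof
  have hxc : g '' C α ⊆ c := by
    rintro _ ⟨k, hk, rfl⟩
    exact (hCE hk).2
  have hxρ : g '' C α ⊆ Set.Iic ρ := hxc.trans hcρ
  have hα0 : 0 < α := by
    rw [pos_iff_ne_zero]
    rintro rfl
    rw [Ordinal.cof_zero] at hαcof
    exact absurd hαcof.symm (Order.bot_lt_succ η).ne'
  obtain ⟨k0, hk0, -⟩ := hC3 0 hα0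
  obtain ⟨m, hm, hmax⟩ := h7 _ hxρ ⟨_, k0, hk0, rfl⟩
  obtain ⟨y, hyx, ⟨f, hf⟩, hmy⟩ := h6 _ hxρ m hm
  have hchoice : ∀ z : y, ∃ k, k ∈ C α ∧ g k = z.1 := fun z => hyx z.2
  choose kk hkkC hkkg using hchoice
  have hβ0 : (⨆ z, kk z) < α := by
    refine aux_iSup_lt ?_ fun z => hC1 _ (hkkC z)
    have h := Cardinal.mk_le_of_injective hf
    rw [Cardinal.mk_Iio_ordinal, Cardinal.card_ord] at h
    refine h.trans_lt ?_
    rw [hαcof, Cardinal.lift_lt]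
    exact Order.lt_succ η
  obtain ⟨β, hβC, hβ⟩ := hC3 _ hβ0
  obtain ⟨k, hkC, hk⟩ := hC3 _ (hC1 _ hβC)
  have hkb : BddAbove (range kk) := ⟨α, by rintro _ ⟨z, rfl⟩; exact (hC1 _ (hkkC z)).le⟩
  have hsx : {o | ∃ k, k < β ∧ k ∈ C α ∧ g k = o} ⊆ g '' C α := by
    rintro _ ⟨k, -, hk, rfl⟩
    exact ⟨k, hk, rfl⟩
  have hys : y ⊆ {o | ∃ k, k < β ∧ k ∈ C α ∧ g k = o} := fun z hz =>
    ⟨kk ⟨z, hz⟩, (le_ciSup hkb ⟨z, hz⟩).trans_lt hβ, hkkC _, hkkg _⟩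
  have hms := h3 _ _ hys (hsx.trans hxρ) hmy
  have hmκ : m < κ := lt_of_le_of_lt (hclc (h3 _ _ hxc hcρ hm)) hδκ
  have hmF := hFle _ m hmκ hms fun z hz => hmax z (h3 _ _ hsx hxρ hz)
  have h9 := hstepF k β α hk hαlam
  exact absurd (hmax _ (h2 _ hxρ ⟨k, hkC, rfl⟩)) (not_le.2 (hmF.trans_lt h9))
end
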